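/- Assuming strong duality holds, for every empirical model e with CF(e) > 0 and every ε > 0 there exists a generalised Bell inequality (β, 0) whose normalised violation by e is at least CF(e) − ε. -/

import Mathlib

open MeasureTheory
open scoped ENNReal ZeroAtInfty BoundedContinuousFunction

/-- The projection from the global outcome space onto the outcomes of a context `C`. -/
def proj {X : Type*} {O : X → Type*} (C : Set X) (g : ∀ x, O x) : ∀ x : C, O x :=
  fun x => g x

/-- The noncontextual fraction. -/
noncomputable def NCF {G : Type*} [MeasurableSpace G] {I : Type*} (M : Finset I)
    {Gc : I → Type*} [∀ i, MeasurableSpace (Gc i)] (π : ∀ i, G → Gc i)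
    (e : ∀ i, Measure (Gc i)) : ℝ≥0∞ :=
  sSup { r | ∃ μ : Measure G, (∀ i ∈ M, μ.map (π i) ≤ e i) ∧ r = μ Set.univ }

open scoped CompactlySupported
/-- A positive linear functional on `G →ᵇ ℝ`, restricted to compactly supported functions. -/
noncomputable def restrictCompactlySupported {G : Type*} [TopologicalSpace G]
    (L : (G →ᵇ ℝ) →ₗ[ℝ] ℝ) (hL : ∀ h, 0 ≤ h → 0 ≤ L h) : C_c(G, ℝ) →ₚ[ℝ] ℝ :=
  PositiveLinearMap.mk₀
    { toFun := fun f => L f.toBoundedContinuousFunction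
      map_add' := fun f g => by rw [← map_add]; rfl
      map_smul' := fun c f => by rw [RingHom.id_apply, ← map_smul]; rfl }
    (fun f hf => hL _ (fun x => hf x))

theorem NCF_ne_top {G : Type*} [MeasurableSpace G] {I : Type*} {M : Finset I} (hM : M.Nonempty)
    {Gc : I → Type*} [∀ i, MeasurableSpace (Gc i)] {π : ∀ i, G → Gc i}
    {e : ∀ i, Measure (Gc i)} (he : ∀ i ∈ M, IsFiniteMeasure (e i))
    (hπ : ∀ i, Measurable (π i)) : NCF M π e ≠ ∞ := by
  obtain ⟨i, hi⟩ := hM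
  have := he i hi
  refine ne_top_of_le_ne_top (measure_ne_top (e i) Set.univ) (sSup_le ?_)
  rintro _ ⟨μ, hμ, rfl⟩
  have := hμ i hi Set.univ
  rwa [Measure.map_apply (hπ i) MeasurableSet.univ, Set.preimage_univ] at this

section Duality

variable {G : Type*} [TopologicalSpace G] {I : Type*} (M : Finset I)
  {Gc : I → Type*} [∀ i, TopologicalSpace (Gc i)] (π : ∀ i, C(G, Gc i))

/-- Families of nonnegative bounded continuous functions on the `Gc i` whose pullbacks to `G`
sum to at least `h`. -/
def IsDominating (h : G →ᵇ ℝ) (f : ∀ i, Gc i →ᵇ ℝ) : Prop :=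
  (∀ i ∈ M, ∀ y, 0 ≤ f i y) ∧ ∀ g, h g ≤ ∑ i ∈ M, f i (π i g)

variable {M π} in
theorem exists_isDominating (hM : M.Nonempty) (h : G →ᵇ ℝ) : ∃ f, IsDominating M π h f := by
  obtain ⟨i, hi⟩ := hM
  refine ⟨fun i => BoundedContinuousFunction.const _ ‖h‖, fun _ _ _ => norm_nonneg h, fun g => ?_⟩
  calc h g ≤ ‖h‖ := (le_abs_self _).trans (h.norm_coe_le_norm g)
    _ ≤ ∑ i ∈ M, ‖h‖ :=
      Finset.single_le_sum (f := fun _ => ‖h‖) (fun _ _ => norm_nonneg _) hi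

variable [∀ i, MeasurableSpace (Gc i)] (e : ∀ i, Measure (Gc i))

/-- The least total integral of a family dominating `h`. -/
noncomputable def dualValue (h : G →ᵇ ℝ) : ℝ :=
  sInf ((fun f : ∀ i, Gc i →ᵇ ℝ => ∑ i ∈ M, ∫ y, f i y ∂(e i)) '' {f | IsDominating M π h f})

variable {M π e}

theorem IsDominating.sum_integral_nonneg {h : G →ᵇ ℝ} {f : ∀ i, Gc i →ᵇ ℝ}
    (hf : IsDominating M π h f) : 0 ≤ ∑ i ∈ M, ∫ y, f i y ∂(e i) :=
  Finset.sum_nonneg fun i hi => integral_nonneg (hf.1 i hi)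

theorem dualValue_le {h : G →ᵇ ℝ} {f : ∀ i, Gc i →ᵇ ℝ} (hf : IsDominating M π h f) :
    dualValue M π e h ≤ ∑ i ∈ M, ∫ y, f i y ∂(e i) :=
  csInf_le ⟨0, by rintro _ ⟨f, hf, rfl⟩; exact hf.sum_integral_nonneg⟩ ⟨f, hf, rfl⟩

theorem le_dualValue (hM : M.Nonempty) {h : G →ᵇ ℝ} {a : ℝ}
    (ha : ∀ f, IsDominating M π h f → a ≤ ∑ i ∈ M, ∫ y, f i y ∂(e i)) :
    a ≤ dualValue M π e h := by
  obtain ⟨f, hf⟩ := exists_isDominating (π := π) hM h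
  refine le_csInf ⟨_, f, hf, rfl⟩ ?_
  rintro _ ⟨f, hf, rfl⟩
  exact ha f hf

theorem dualValue_nonneg (hM : M.Nonempty) (h : G →ᵇ ℝ) : 0 ≤ dualValue M π e h :=
  le_dualValue hM fun _ hf => hf.sum_integral_nonneg

theorem dualValue_nonpos {h : G →ᵇ ℝ} (hh : h ≤ 0) : dualValue M π e h ≤ 0 := by
  have hf : IsDominating M π h (fun i => 0) := ⟨by simp, fun g => by simpa using hh g⟩
  simpa using dualValue_le (e := e) hf

theorem dualValue_smul_le (hM : M.Nonempty) {c : ℝ} (hc : 0 < c) (h : G →ᵇ ℝ) :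
    dualValue M π e (c • h) ≤ c * dualValue M π e h := by
  rw [← div_le_iff₀' hc]
  refine le_dualValue hM fun f hf => ?_
  rw [div_le_iff₀' hc]
  have hcf : IsDominating M π (c • h) (fun i => c • f i) := by
    refine ⟨fun i hi y => mul_nonneg hc.le (hf.1 i hi y), fun g => ?_⟩
    simpa [Finset.mul_sum] using mul_le_mul_of_nonneg_left (hf.2 g) hc.le
  refine (dualValue_le hcf).trans_eq ?_
  simp [Finset.mul_sum, integral_const_mul]

theorem dualValue_smul (hM : M.Nonempty) {c : ℝ} (hc : 0 < c) (h : G →ᵇ ℝ) :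
    dualValue M π e (c • h) = c * dualValue M π e h := by
  refine le_antisymm (dualValue_smul_le hM hc h) ?_
  have := dualValue_smul_le (π := π) (e := e) hM (inv_pos.2 hc) (c • h)
  rw [inv_smul_smul₀ hc.ne'] at this
  rwa [le_inv_mul_iff₀ hc] at this

variable [∀ i, OpensMeasurableSpace (Gc i)]

theorem dualValue_add_le (hM : M.Nonempty) (he : ∀ i ∈ M, IsFiniteMeasure (e i))
    (h k : G →ᵇ ℝ) :
    dualValue M π e (h + k) ≤ dualValue M π e h + dualValue M π e k := by
  rw [← sub_le_iff_le_add]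
  refine le_dualValue hM fun f hf => ?_
  rw [sub_le_comm]
  refine le_dualValue hM fun f' hf' => ?_
  rw [sub_le_iff_le_add']
  have hff : IsDominating M π (h + k) (fun i => f i + f' i) := by
    refine ⟨fun i hi y => add_nonneg (hf.1 i hi y) (hf'.1 i hi y), fun g => ?_⟩
    simpa [Finset.sum_add_distrib] using add_le_add (hf.2 g) (hf'.2 g)
  refine (dualValue_le hff).trans_eq ?_
  rw [← Finset.sum_add_distrib]
  refine Finset.sum_congr rfl fun i hi => ?_
  have := he i hi
  exact integral_add ((f i).integrable _) ((f' i).integrable _)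

theorem exists_positive_functional [Nonempty G] (hM : M.Nonempty)
    (he : ∀ i ∈ M, IsFiniteMeasure (e i)) :
    ∃ L : (G →ᵇ ℝ) →ₗ[ℝ] ℝ, (∀ h, 0 ≤ h → 0 ≤ L h) ∧
      (∀ i ∈ M, ∀ f : Gc i →ᵇ ℝ, 0 ≤ f → L (f.compContinuous (π i)) ≤ ∫ y, f y ∂(e i)) ∧
      L 1 = dualValue M π e 1 := by
  classical
  set p := dualValue M π e 1 with hp
  have hspan : ∀ c : ℝ, c • (1 : G →ᵇ ℝ) = 0 → (RingHom.id ℝ) c • p = 0 := fun c hc => by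
    rcases smul_eq_zero.1 hc with h | h
    · simp [h]
    · obtain ⟨g⟩ := ‹Nonempty G›
      exact absurd (DFunLike.congr_fun h g) (one_ne_zero (α := ℝ))
  obtain ⟨L, hL1, hLle⟩ := exists_extension_of_le_sublinear
    (LinearPMap.mkSpanSingleton' (1 : G →ᵇ ℝ) p hspan) (dualValue M π e)
    (fun c hc h => dualValue_smul hM hc h) (dualValue_add_le hM he) (by
      rintro ⟨x, hx⟩
      obtain ⟨c, rfl⟩ := Submodule.mem_span_singleton.1 hx
      rw [LinearPMap.mkSpanSingleton'_apply]
      rcases le_or_gt c 0 with hc | hc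
      · exact (mul_nonpos_of_nonpos_of_nonneg hc (dualValue_nonneg hM _)).trans
          (dualValue_nonneg hM _)
      · exact (dualValue_smul hM hc 1).ge)
  refine ⟨L, fun h hh => ?_, fun i hi f hf => ?_, ?_⟩
  · have := (hLle (-h)).trans (dualValue_nonpos (neg_nonpos.2 hh))
    rw [map_neg] at this
    linarith
  · have hdom : IsDominating M π (f.compContinuous (π i)) (Pi.single i f) := by
      refine ⟨fun j _ y => ?_, fun g => ?_⟩
      · rcases eq_or_ne j i with rfl | hj
        · simpa using hf y
        · simp [Pi.single_eq_of_ne hj]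
      · rw [Finset.sum_eq_single_of_mem i hi fun j _ hj => by simp [Pi.single_eq_of_ne hj]]
        simp
    refine ((hLle _).trans (dualValue_le hdom)).trans_eq ?_
    rw [Finset.sum_eq_single_of_mem i hi fun j _ hj => by simp [Pi.single_eq_of_ne hj]]
    simp
  · have := hL1 ⟨1, Submodule.mem_span_singleton_self 1⟩
    exact this.trans (LinearPMap.mkSpanSingleton'_apply_self _ _ _ _)

variable [T2Space G] [LocallyCompactSpace G] [MeasurableSpace G] [BorelSpace G]
  [∀ i, T2Space (Gc i)] [∀ i, LocallyCompactSpace (Gc i)] [∀ i, SecondCountableTopology (Gc i)]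
  [∀ i, BorelSpace (Gc i)]

theorem map_rieszMeasure_le {L : (G →ᵇ ℝ) →ₗ[ℝ] ℝ} (hL : ∀ h, 0 ≤ h → 0 ≤ L h) {i : I}
    [IsFiniteMeasure (e i)]
    (hLe : ∀ f : Gc i →ᵇ ℝ, 0 ≤ f → L (f.compContinuous (π i)) ≤ ∫ y, f y ∂(e i)) :
    (RealRMK.rieszMeasure (restrictCompactlySupported L hL)).map (π i) ≤ e i := by
  set μ := RealRMK.rieszMeasure (restrictCompactlySupported L hL) with hμ
  have hopen : ∀ U : Set (Gc i), IsOpen U → μ (π i ⁻¹' U) ≤ e i U := by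
    intro U hU
    rw [(hU.preimage (π i).continuous).measure_eq_iSup_isCompact]
    refine iSup₂_le fun K hKU => iSup_le fun hK => ?_
    obtain ⟨k, hk1, hk0, -, hk⟩ := exists_continuous_one_zero_of_isCompact
      (hK.image (π i).continuous) hU.isClosed_compl
      (Set.disjoint_compl_right_iff_subset.2 (Set.image_subset_iff.2 hKU))
    obtain ⟨c, hc1, -, hcs, hc⟩ := exists_continuous_one_zero_of_isCompact hK isClosed_empty
      (Set.disjoint_empty K)
    let F : C_c(G, ℝ) := ⟨⟨fun g => c g * k (π i g), by fun_prop⟩, hcs.mul_right⟩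
    let kb : Gc i →ᵇ ℝ := BoundedContinuousFunction.ofNormedAddCommGroup k k.continuous 1
      fun y => by rw [Real.norm_of_nonneg (hk y).1]; exact (hk y).2
    have hF0 : ∀ g, 0 ≤ F g := fun g => mul_nonneg (hc g).1 (hk _).1
    have hF1 : ∀ g ∈ K, F g = 1 := fun g hg => by
      change c g * k (π i g) = 1
      rw [hc1 hg, hk1 ⟨g, hg, rfl⟩]
      simp
    refine (RealRMK.rieszMeasure_le_of_eq_one _ hF0 hK hF1).trans ?_
    have hLF : L F.toBoundedContinuousFunction ≤ L (kb.compContinuous (π i)) := by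
      rw [← sub_nonneg, ← map_sub]
      refine hL _ fun g => sub_nonneg.2 ?_
      exact mul_le_of_le_one_left (hk _).1 (hc g).2
    have hint : ∫ y, kb y ∂(e i) ≤ (e i).real U := by
      rw [← integral_indicator_one hU.measurableSet]
      refine integral_mono (kb.integrable _)
        ((integrable_const (1 : ℝ)).indicator hU.measurableSet) fun y => ?_
      by_cases hy : y ∈ U
      · simpa [kb, hy] using (hk y).2
      · simpa [kb, hy] using (hk0 hy).le
    refine ENNReal.ofReal_le_of_le_toReal ?_
    exact (hLF.trans (hLe kb fun y => (hk y).1)).trans hint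
  refine Measure.le_iff.2 fun s hs => ?_
  rw [Measure.map_apply (π i).continuous.measurable hs]
  refine ENNReal.le_of_forall_pos_le_add fun ε hε _ => ?_
  obtain ⟨U, hsU, hU, hlt⟩ := s.exists_isOpen_lt_add (μ := e i) (measure_ne_top _ _)
    (ENNReal.coe_ne_zero.2 hε.ne')
  exact ((measure_mono (Set.preimage_mono hsU)).trans (hopen U hU)).trans hlt.le

theorem ofReal_le_rieszMeasure_univ (he : ∀ i ∈ M, IsFiniteMeasure (e i))
    (hproper : ∀ K : ∀ i, Set (Gc i), (∀ i ∈ M, IsCompact (K i)) →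
      IsCompact (⋂ i ∈ M, π i ⁻¹' K i))
    {L : (G →ᵇ ℝ) →ₗ[ℝ] ℝ} (hL : ∀ h, 0 ≤ h → 0 ≤ L h)
    (hLe : ∀ i ∈ M, ∀ f : Gc i →ᵇ ℝ, 0 ≤ f → L (f.compContinuous (π i)) ≤ ∫ y, f y ∂(e i)) :
    ENNReal.ofReal (L 1) ≤
      RealRMK.rieszMeasure (restrictCompactlySupported L hL) Set.univ := by
  refine ENNReal.le_of_forall_pos_le_add fun ε hε _ => ?_
  have hcard : (0 : ℝ) < M.card + 1 := by positivity
  set δ : ℝ := ε / (M.card + 1) with hδ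
  have hδ0 : 0 < δ := div_pos hε hcard
  have key : ∀ i, ∃ k : Gc i →ᵇ ℝ, HasCompactSupport k ∧ (∀ y, k y ∈ Set.Icc (0 : ℝ) 1) ∧
      (i ∈ M → ∫ y, (1 - k) y ∂(e i) ≤ δ) := by
    intro i
    by_cases hi : i ∈ M
    swap
    · exact ⟨0, HasCompactSupport.zero, by simp, fun h => absurd h hi⟩
    have := he i hi
    obtain ⟨K, -, hK, hlt⟩ := (MeasurableSet.univ (α := Gc i)).exists_isCompact_sdiff_lt
      (μ := e i) (measure_ne_top _ _) (ENNReal.ofReal_pos.2 hδ0).ne'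
    obtain ⟨k, hk1, -, hks, hk⟩ := exists_continuous_one_zero_of_isCompact hK isClosed_empty
      (Set.disjoint_empty K)
    let kb : Gc i →ᵇ ℝ := BoundedContinuousFunction.ofNormedAddCommGroup k k.continuous 1
      fun y => by rw [Real.norm_of_nonneg (hk y).1]; exact (hk y).2
    refine ⟨kb, hks, hk, fun _ => ?_⟩
    have hmeas : MeasurableSet (Set.univ \ K) := MeasurableSet.univ.diff hK.measurableSet
    have hint : ∫ y, (1 - kb) y ∂(e i) ≤ (e i).real (Set.univ \ K) := by
      rw [← integral_indicator_one hmeas]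
      refine integral_mono ((1 - kb).integrable _)
        ((integrable_const (1 : ℝ)).indicator hmeas) fun y => ?_
      by_cases hy : y ∈ K
      · have h1 : k y = 1 := hk1 hy
        simp [kb, hy, h1]
      · simpa [kb, hy] using (hk y).1
    exact hint.trans (ENNReal.toReal_le_of_le_ofReal hδ0.le hlt.le)
  choose k hks hk hkint using key
  obtain ⟨c, hc1, -, hcs, hc⟩ := exists_continuous_one_zero_of_isCompact
    (hproper (fun i => tsupport (k i)) fun i _ => hks i) isClosed_empty (Set.disjoint_empty _)
  let F : C_c(G, ℝ) := ⟨c, hcs⟩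
  have hF : ENNReal.ofReal (L F.toBoundedContinuousFunction) ≤
      RealRMK.rieszMeasure (restrictCompactlySupported L hL) Set.univ :=
    RealRMK.le_rieszMeasure_tsupport_subset (restrictCompactlySupported L hL) (f := F)
      (fun g => hc g) (Set.subset_univ _)
  have hdom : L 1 ≤ L (F.toBoundedContinuousFunction +
      ∑ i ∈ M, (1 - k i).compContinuous (π i)) := by
    rw [← sub_nonneg, ← map_sub]
    refine hL _ fun g => sub_nonneg.2 ?_
    have hnn : ∀ i ∈ M, 0 ≤ 1 - k i (π i g) := fun i _ => sub_nonneg.2 (hk i _).2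
    change 1 ≤ c g + (∑ i ∈ M, (1 - k i).compContinuous (π i)) g
    rw [BoundedContinuousFunction.sum_apply]
    change 1 ≤ c g + ∑ i ∈ M, (1 - k i (π i g))
    by_cases hg : g ∈ ⋂ i ∈ M, π i ⁻¹' tsupport (k i)
    · rw [hc1 hg]
      simpa using Finset.sum_nonneg hnn
    · simp only [Set.mem_iInter, not_forall] at hg
      obtain ⟨i, hi, hgi⟩ := hg
      have h0 : k i (π i g) = 0 := image_eq_zero_of_notMem_tsupport hgi
      have := Finset.single_le_sum hnn hi
      rw [h0] at this
      linarith [(hc g).1]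
  have hsum : ∑ i ∈ M, L ((1 - k i).compContinuous (π i)) ≤ ε := by
    calc ∑ i ∈ M, L ((1 - k i).compContinuous (π i)) ≤ ∑ i ∈ M, δ :=
          Finset.sum_le_sum fun i hi =>
            (hLe i hi (1 - k i) fun y => sub_nonneg.2 (hk i y).2).trans (hkint i hi)
      _ = M.card * δ := by simp
      _ ≤ (M.card + 1) * δ := by nlinarith
      _ = ε := by rw [hδ]; field_simp
  rw [map_add, map_sum] at hdom
  calc ENNReal.ofReal (L 1) ≤ ENNReal.ofReal (L F.toBoundedContinuousFunction + ε) :=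
        ENNReal.ofReal_le_ofReal (by linarith)
    _ ≤ ENNReal.ofReal (L F.toBoundedContinuousFunction) + ENNReal.ofReal ε :=
        ENNReal.ofReal_add_le
    _ ≤ _ := by rw [ENNReal.ofReal_coe_nnreal]; gcongr

/-- Strong duality between `NCF` and bounded continuous dual solutions. -/
theorem dualValue_one_le_toReal_NCF [Nonempty G] (hM : M.Nonempty)
    (he : ∀ i ∈ M, IsFiniteMeasure (e i))
    (hproper : ∀ K : ∀ i, Set (Gc i), (∀ i ∈ M, IsCompact (K i)) →
      IsCompact (⋂ i ∈ M, π i ⁻¹' K i)) :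
    dualValue M π e 1 ≤ (NCF M (fun i => π i) e).toReal := by
  obtain ⟨L, hL, hLe, hL1⟩ := exists_positive_functional (π := π) (e := e) hM he
  have hfin := NCF_ne_top (e := e) hM he fun i => (π i).continuous.measurable
  rw [← hL1, ← ENNReal.ofReal_le_iff_le_toReal hfin]
  refine (ofReal_le_rieszMeasure_univ he hproper hL hLe).trans (le_sSup ⟨_, fun i hi => ?_, rfl⟩)
  have := he i hi
  exact map_rieszMeasure_le hL (hLe i hi)

end Duality

section Coordinates

variable {X : Type*} {O : X → Type*} [∀ x, TopologicalSpace (O x)]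

theorem continuous_proj (C : Set X) : Continuous (proj C (O := O)) :=
  continuous_pi fun x => continuous_apply (x : X)

open scoped Classical in
/-- Extend a partial assignment on `U` by the default values `d`. -/
noncomputable def extendAssignment (U : Set X) (d : ∀ x, O x) : C(∀ x : U, O x, ∀ x, O x) where
  toFun g x := if h : x ∈ U then g ⟨x, h⟩ else d x
  continuous_toFun := continuous_pi fun x => by
    by_cases h : x ∈ U
    · simpa [h] using continuous_apply (⟨x, h⟩ : U)
    · simpa [h] using continuous_const

theorem extendAssignment_apply_of_mem {U : Set X} (d : ∀ x, O x) (g : ∀ x : U, O x) {x : X}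
    (h : x ∈ U) : extendAssignment U d g x = g ⟨x, h⟩ := by
  simp [extendAssignment, h]

theorem isCompact_iInter_preimage_proj_extendAssignment [∀ x, T2Space (O x)]
    (M : Finset (Set X)) (d : ∀ x, O x) (K : ∀ C : Set X, Set (∀ x : C, O x))
    (hK : ∀ C ∈ M, IsCompact (K C)) :
    IsCompact (⋂ C ∈ M, (fun g => proj C (extendAssignment (⋃ C ∈ M, C) d g)) ⁻¹' K C) := by
  have hU : ∀ x : (⋃ C ∈ M, C : Set X), ∃ C ∈ M, (x : X) ∈ C := fun x => by
    obtain ⟨C, hC, hx⟩ := Set.mem_iUnion₂.1 x.2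
    exact ⟨C, hC, hx⟩
  choose C hCM hxC using hU
  refine (isCompact_univ_pi fun x => (hK (C x) (hCM x)).image
    (continuous_apply (⟨x, hxC x⟩ : C x))).of_isClosed_subset ?_ ?_
  · exact isClosed_biInter fun C hC => (hK C hC).isClosed.preimage
      ((continuous_proj C).comp (extendAssignment _ d).continuous)
  · intro g hg x _
    simp only [Set.mem_iInter] at hg
    exact ⟨_, hg (C x) (hCM x), extendAssignment_apply_of_mem d g x.2⟩

end Coordinates

/-- Strong duality for the noncontextual fraction, with bounded continuous dual solutions. -/
theorem exists_dual_solution_lt {X : Type*} [Finite X] {O : X → Type*}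
    [∀ x, TopologicalSpace (O x)] [∀ x, SecondCountableTopology (O x)]
    [∀ x, LocallyCompactSpace (O x)] [∀ x, T2Space (O x)]
    [∀ x, MeasurableSpace (O x)] [∀ x, BorelSpace (O x)]
    {M : Finset (Set X)} (hM : M.Nonempty)
    {e : ∀ C : Set X, Measure (∀ x : C, O x)} (he : ∀ C ∈ M, IsFiniteMeasure (e C))
    {ε : ℝ} (hε : 0 < ε) :
    ∃ f : ∀ C : Set X, ((∀ x : C, O x) →ᵇ ℝ),
      (∀ C ∈ M, ∀ y, 0 ≤ f C y) ∧
      (∀ g : ∀ x, O x, 1 ≤ ∑ C ∈ M, f C (proj C g)) ∧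
      ∑ C ∈ M, ∫ y, f C y ∂(e C) <
        (NCF M (fun C : Set X => proj C (O := O)) e).toReal + ε := by
  rcases isEmpty_or_nonempty (∀ x, O x) with hO | ⟨⟨d⟩⟩
  · refine ⟨fun _ => 0, by simp, fun g => isEmptyElim g, ?_⟩
    simp only [BoundedContinuousFunction.coe_zero, Pi.zero_apply, integral_zero,
      Finset.sum_const_zero]
    exact add_pos_of_nonneg_of_pos ENNReal.toReal_nonneg hε
  set U : Set X := ⋃ C ∈ M, C
  let s := extendAssignment U d
  let π : ∀ C : Set X, C(∀ x : U, O x, ∀ x : C, O x) := fun C =>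
    (⟨proj C, continuous_proj C⟩ : C(∀ x, O x, ∀ x : C, O x)).comp s
  have : Nonempty (∀ x : U, O x) := ⟨proj U d⟩
  have hNCF : NCF M (fun C => π C) e ≤ NCF M (fun C : Set X => proj C (O := O)) e := by
    refine sSup_le ?_
    rintro _ ⟨μ, hμ, rfl⟩
    refine le_sSup ⟨μ.map s, fun C hC => ?_, ?_⟩
    · rw [Measure.map_map (continuous_proj C).measurable s.continuous.measurable]
      exact hμ C hC
    · rw [Measure.map_apply s.continuous.measurable MeasurableSet.univ, Set.preimage_univ]
  have hfin : NCF M (fun C : Set X => proj C (O := O)) e ≠ ∞ :=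
    NCF_ne_top hM he fun C => (continuous_proj C).measurable
  have hdual := dualValue_one_le_toReal_NCF (π := π) hM he
    (isCompact_iInter_preimage_proj_extendAssignment M d)
  obtain ⟨f, hf, hlt⟩ : ∃ f, IsDominating M π 1 f ∧ ∑ C ∈ M, ∫ y, f C y ∂(e C) <
      (NCF M (fun C : Set X => proj C (O := O)) e).toReal + ε := by
    by_contra! h
    have := (le_dualValue hM h).trans (hdual.trans (ENNReal.toReal_mono hfin hNCF))
    linarith
  refine ⟨f, hf.1, fun g => ?_, hlt⟩
  refine (hf.2 (proj U g)).trans_eq (Finset.sum_congr rfl fun C hC => ?_)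
  congr 1
  funext x
  exact extendAssignment_apply_of_mem d _ (Set.mem_biUnion hC x.2)

/-- assuming strong duality, for every empirical model `e` with
`CF(e) > 0` and every `ε > 0` there is a generalised Bell inequality `(β, 0)` whose
normalised violation `max {0, ⟨β, e⟩} / ‖β‖` by `e` is at least `CF(e) - ε`. -/
theorem exists_bell_inequality_near_cf {X : Type*} [Fintype X] {O : X → Type*}
    [∀ x, TopologicalSpace (O x)] [∀ x, SecondCountableTopology (O x)]
    [∀ x, LocallyCompactSpace (O x)] [∀ x, T2Space (O x)]
    [∀ x, MeasurableSpace (O x)] [∀ x, BorelSpace (O x)]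
    (M : Finset (Set X)) (hM : M.Nonempty)
    (e : ∀ C : Set X, Measure (∀ x : C, O x))
    (he : ∀ C ∈ M, IsProbabilityMeasure (e C))
    (hduality : (NCF M (fun C : Set X => proj C (O := O)) e).toReal =
      sInf { r : ℝ | ∃ f : ∀ C : Set X, C₀((∀ x : C, O x), ℝ),
        (∀ C ∈ M, ∀ y, 0 ≤ f C y) ∧
        (∀ g : ∀ x, O x, 1 ≤ ∑ C ∈ M, f C (proj C g)) ∧
        r = ∑ C ∈ M, ∫ y, f C y ∂(e C) })
    (hcf : 0 < 1 - (NCF M (fun C : Set X => proj C (O := O)) e).toReal)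
    {ε : ℝ} (hε : 0 < ε) :
    ∃ β : ∀ C : Set X, ((∀ x : C, O x) →ᵇ ℝ),
      (∀ e' : ∀ C : Set X, Measure (∀ x : C, O x),
        (∀ C ∈ M, IsProbabilityMeasure (e' C)) →
        (∃ μ : Measure (∀ x, O x), IsProbabilityMeasure μ ∧
          ∀ C ∈ M, μ.map (proj C) = e' C) →
        ∑ C ∈ M, ∫ y, β C y ∂(e' C) ≤ 0) ∧
      1 - (NCF M (fun C : Set X => proj C (O := O)) e).toReal - ε ≤
        max 0 (∑ C ∈ M, ∫ y, β C y ∂(e C)) / (∑ C ∈ M, ⨆ o, β C o) := by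
  have hefin : ∀ C ∈ M, IsFiniteMeasure (e C) := fun C hC => by
    have := he C hC
    infer_instance
  obtain ⟨f, hf0, hf1, hlt⟩ := exists_dual_solution_lt hM hefin hε
  have hcard : (0 : ℝ) < M.card := by exact_mod_cast hM.card_pos
  let β : ∀ C : Set X, ((∀ x : C, O x) →ᵇ ℝ) := fun C =>
    BoundedContinuousFunction.const _ (M.card : ℝ)⁻¹ - f C
  have hsum : ∀ e' : ∀ C : Set X, Measure (∀ x : C, O x),
      (∀ C ∈ M, IsProbabilityMeasure (e' C)) →
      ∑ C ∈ M, ∫ y, β C y ∂(e' C) =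
        1 - ∑ C ∈ M, ∫ y, f C y ∂(e' C) := by
    intro e' he'
    have hC : ∀ C ∈ M,
        ∫ y, β C y ∂(e' C) =
          (M.card : ℝ)⁻¹ - ∫ y, f C y ∂(e' C) := fun C hC => by
      have := he' C hC
      simp only [β, BoundedContinuousFunction.sub_apply, BoundedContinuousFunction.const_apply]
      rw [integral_sub (integrable_const _) ((f C).integrable _)]
      simp
    rw [Finset.sum_congr rfl hC, Finset.sum_sub_distrib]
    simp [hcard.ne']
  refine ⟨β, ?_, ?_⟩
  · rintro e' he' ⟨μ, hμ, hmap⟩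
    rw [hsum e' he', sub_nonpos]
    have hint : ∀ C ∈ M, Integrable (fun g => f C (proj C g)) μ := fun C _ =>
      ((f C).compContinuous ⟨proj C, continuous_proj C⟩).integrable μ
    calc (1 : ℝ) = ∫ g, 1 ∂μ := by simp
      _ ≤ ∫ g, ∑ C ∈ M, f C (proj C g) ∂μ :=
        integral_mono (integrable_const _) (integrable_finsetSum _ hint) hf1
      _ = ∑ C ∈ M, ∫ g, f C (proj C g) ∂μ := integral_finsetSum _ hint
      _ = ∑ C ∈ M, ∫ y, f C y ∂(e' C) := Finset.sum_congr rfl fun C hC => by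
        rw [← hmap C hC, integral_map (continuous_proj C).measurable.aemeasurable
          (f C).continuous.aestronglyMeasurable]
  · set D := ∑ C ∈ M, ⨆ o, β C o
    set V := ∑ C ∈ M, ∫ y, β C y ∂(e C)
      with hV
    have hD1 : D ≤ 1 := by
      calc D ≤ ∑ C ∈ M, (M.card : ℝ)⁻¹ := Finset.sum_le_sum fun C hC =>
            Real.iSup_le (fun o => sub_le_self _ (hf0 C hC o)) (inv_pos.2 hcard).le
        _ = 1 := by simp [hcard.ne']
    have hVD : V ≤ D := Finset.sum_le_sum fun C hC => by
      have := he C hC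
      calc ∫ y, β C y ∂(e C) ≤ ∫ _, (⨆ o, β C o) ∂(e C) :=
            integral_mono ((β C).integrable _) (integrable_const _) fun y =>
              le_ciSup (β C).isBounded_range.bddAbove y
        _ = ⨆ o, β C o := by simp
    have htarget : 1 - (NCF M (fun C : Set X => proj C (O := O)) e).toReal - ε ≤ V := by
      rw [hV, hsum e he]
      linarith
    rcases le_or_gt V 0 with hV0 | hV0
    · rw [max_eq_left hV0, zero_div]
      exact htarget.trans hV0
    · rw [max_eq_right hV0.le]
      exact htarget.trans (le_div_self hV0.le (hV0.trans_le hVD) hD1)
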